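/- Let D be a 3-dicritical semi-complete digraph. Then D contains neither F⁺ nor F⁻ as a subdigraph, where: F is the oriented graph on vertices u1,…,u6, x1, x2, x3 in which {u1,…,u6} induces a transitive tournament with acyclic ordering u1,…,u6 and, for each i ∈ {1,2,3}, the arcs u_{2i} x_i and x_i u_{2i−1} are present; F⁺ is obtained from F by adding a vertex u0 and all arcs u0 u_i for i ∈ {1,…,6}; and F⁻ is obtained from F by adding a vertex u7 and all arcs u_i u7 for i ∈ {1,…,6}. -/

import Mathlib

/-- A (loopless, simple) digraph on vertex type `V`. -/
structure SimpleDigraph (V : Type) where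
  Adj : V → V → Prop
  loopless : ∀ v, ¬ Adj v v

namespace SimpleDigraph

/-- A set of arcs (given as a relation) is acyclic if it admits no directed closed walk. -/
def AcyclicRel {V : Type} (A : V → V → Prop) : Prop :=
  ∀ v, ¬ Relation.TransGen A v v

/-- A set of arcs is 2-dicolourable if the vertices can be coloured with two colours
so that each colour class induces an acyclic subdigraph. -/
def Dicolourable2Rel {V : Type} (A : V → V → Prop) : Prop :=
  ∃ φ : V → Fin 2, ∀ i : Fin 2,
    AcyclicRel (fun a b => A a b ∧ φ a = i ∧ φ b = i)

/-- A digraph is 2-dicolourable if its vertices can be coloured with two colours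
so that each colour class induces an acyclic subdigraph. -/
def Dicolourable2 {V : Type} (D : SimpleDigraph V) : Prop :=
  Dicolourable2Rel D.Adj

/-- `(S, A)` describes a subdigraph of `D`: its vertex set is `S` and its arcs
are given by `A`, which must join vertices of `S` and be arcs of `D`. -/
def IsSubdigraphOn {V : Type} (D : SimpleDigraph V) (S : Set V) (A : V → V → Prop) : Prop :=
  ∀ u v, A u v → u ∈ S ∧ v ∈ S ∧ D.Adj u v

/-- `D` is 3-dicritical: `D` is not 2-dicolourable, but every proper subdigraph of `D`
(one missing a vertex or an arc) is 2-dicolourable. -/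
def Dicritical3 {V : Type} (D : SimpleDigraph V) : Prop :=
  ¬ D.Dicolourable2 ∧
    ∀ (S : Set V) (A : V → V → Prop), D.IsSubdigraphOn S A →
      (S ≠ Set.univ ∨ A ≠ D.Adj) → Dicolourable2Rel A

/-- A digraph is semi-complete if any two distinct vertices are joined by at least one arc. -/
def SemiComplete {V : Type} (D : SimpleDigraph V) : Prop :=
  ∀ u v : V, u ≠ v → D.Adj u v ∨ D.Adj v u

/-- A tournament is a semi-complete digraph with no digon. -/
def IsTournament {V : Type} (D : SimpleDigraph V) : Prop :=
  D.SemiComplete ∧ ∀ u v : V, ¬ (D.Adj u v ∧ D.Adj v u)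

/-- Isomorphism of digraphs. -/
def Iso {V W : Type} (D : SimpleDigraph V) (E : SimpleDigraph W) : Prop :=
  ∃ e : V ≃ W, ∀ u v : V, D.Adj u v ↔ E.Adj (e u) (e v)

/-- `D` contains (a copy of) `H` as a subdigraph. -/
def ContainsSub {V W : Type} (D : SimpleDigraph V) (H : SimpleDigraph W) : Prop :=
  ∃ f : W → V, Function.Injective f ∧ ∀ a b, H.Adj a b → D.Adj (f a) (f b)

/-- `D` contains (a copy of) `H` as an induced subdigraph. -/
def ContainsInduced {V W : Type} (D : SimpleDigraph V) (H : SimpleDigraph W) : Prop :=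
  ∃ f : W → V, Function.Injective f ∧ ∀ a b, H.Adj a b ↔ D.Adj (f a) (f b)

end SimpleDigraph

/-- The oriented graph `F⁺` on `Fin 10`: the vertices `0, …, 5` are `u1, …, u6` (inducing
a transitive tournament with acyclic ordering `u1, …, u6`), the vertices `6, 7, 8` are
`x1, x2, x3` with arcs `u_{2i} → x_i → u_{2i-1}`, and the vertex `9` is `u0`, which
dominates `u1, …, u6`. -/
def digraphFplus : SimpleDigraph (Fin 10) :=
  ⟨fun a b => (a.val < b.val ∧ b.val ≤ 5) ∨
      ((a.val, b.val) ∈ [(1,6),(6,0),(3,7),(7,2),(5,8),(8,4)]) ∨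
      (a.val = 9 ∧ b.val ≤ 5), by decide⟩

/-- The oriented graph `F⁻` on `Fin 10`: as `F⁺`, except that the vertex `9` is `u7`,
which is dominated by `u1, …, u6`. -/
def digraphFminus : SimpleDigraph (Fin 10) :=
  ⟨fun a b => (a.val < b.val ∧ b.val ≤ 5) ∨
      ((a.val, b.val) ∈ [(1,6),(6,0),(3,7),(7,2),(5,8),(8,4)]) ∨
      (a.val ≤ 5 ∧ b.val = 9), by decide⟩

namespace SimpleDigraph

variable {V : Type}

/-- The digraph obtained by reversing every arc. -/
def reverse (D : SimpleDigraph V) : SimpleDigraph V :=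
  ⟨fun u v => D.Adj v u, D.loopless⟩

theorem AcyclicRel.swap {A : V → V → Prop} (h : AcyclicRel A) :
    AcyclicRel fun u v => A v u := by
  intro v hv
  exact h v (Relation.transGen_swap.1 hv)

theorem Dicolourable2Rel.swap {A : V → V → Prop} (h : Dicolourable2Rel A) :
    Dicolourable2Rel fun u v => A v u := by
  obtain ⟨φ, hφ⟩ := h
  refine ⟨φ, fun i => ?_⟩
  convert (hφ i).swap using 4
  exact and_comm

theorem Dicritical3.reverse {D : SimpleDigraph V} (hD : D.Dicritical3) :
    D.reverse.Dicritical3 := by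
  refine ⟨fun h => hD.1 (Dicolourable2Rel.swap h), fun S A hA hne => ?_⟩
  refine Dicolourable2Rel.swap (A := fun u v => A v u)
    (hD.2 S _ (fun u v h => ?_) (hne.imp_right fun h h' => h ?_))
  · obtain ⟨hv, hu, huv⟩ := hA v u h
    exact ⟨hu, hv, huv⟩
  · ext u v
    exact iff_of_eq (congrFun (congrFun h' v) u)

theorem SemiComplete.reverse {D : SimpleDigraph V} (hD : D.SemiComplete) :
    D.reverse.SemiComplete :=
  fun u v huv => (hD u v huv).symm

/-- The arcs of `A` other than `ab` whose ends receive the same colour. -/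
def MonoExcept (A : V → V → Prop) (φ : V → Fin 2) (a b u v : V) : Prop :=
  A u v ∧ ¬ (u = a ∧ v = b) ∧ φ u = φ v

theorem transGen_or_of_transGen_insert {R S : V → V → Prop} {a b : V}
    (hS : ∀ u v, S u v → R u v ∨ (u = a ∧ v = b)) {x y : V} (h : Relation.TransGen S x y) :
    Relation.TransGen R x y ∨ (Relation.ReflTransGen R x a ∧ Relation.ReflTransGen R b y) := by
  induction h with
  | single h =>
    rcases hS _ _ h with h | ⟨rfl, rfl⟩
    · exact .inl (.single h)
    · exact .inr ⟨.refl, .refl⟩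
  | tail _ h ih =>
    rcases hS _ _ h with h | ⟨rfl, rfl⟩
    · exact ih.imp (·.tail h) fun ⟨h₁, h₂⟩ => ⟨h₁, h₂.tail h⟩
    · exact .inr ⟨ih.elim (·.to_reflTransGen) (·.1), .refl⟩

/-- In a 3-dicritical digraph, deleting an arc `ab` yields a 2-dicolouring with a monochromatic
path from `b` to `a`. -/
theorem Dicritical3.exists_colouring {D : SimpleDigraph V} (hD : D.Dicritical3) {a b : V}
    (hab : D.Adj a b) :
    ∃ φ : V → Fin 2, φ a = φ b ∧ AcyclicRel (MonoExcept D.Adj φ a b) ∧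
      Relation.TransGen (MonoExcept D.Adj φ a b) b a := by
  obtain ⟨φ, hφ⟩ := hD.2 Set.univ (fun u v => D.Adj u v ∧ ¬ (u = a ∧ v = b))
    (fun u v h => ⟨trivial, trivial, h.1⟩)
    (.inr fun h => by simpa [hab] using congrFun (congrFun h a) b)
  have hac : AcyclicRel (MonoExcept D.Adj φ a b) := by
    intro v hv
    have key : ∀ w, Relation.TransGen (MonoExcept D.Adj φ a b) v w → φ v = φ w ∧
        Relation.TransGen
          (fun x y => (D.Adj x y ∧ ¬ (x = a ∧ y = b)) ∧ φ x = φ v ∧ φ y = φ v) v w := by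
      intro w hw
      induction hw with
      | single h => exact ⟨h.2.2, .single ⟨⟨h.1, h.2.1⟩, rfl, h.2.2.symm⟩⟩
      | tail _ h ih =>
        exact ⟨ih.1.trans h.2.2,
          ih.2.tail ⟨⟨h.1, h.2.1⟩, ih.1.symm, (ih.1.trans h.2.2).symm⟩⟩
    exact hφ (φ v) v (key v hv).2
  have hcyc : ∃ i v, Relation.TransGen (fun x y => D.Adj x y ∧ φ x = i ∧ φ y = i) v v := by
    by_contra! h
    exact hD.1 ⟨φ, h⟩
  obtain ⟨i, v, hv⟩ := hcyc
  have hc : φ a = φ b := by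
    by_contra hne
    refine hac v (Relation.TransGen.mono (fun x y h => ⟨h.1, ?_, h.2.1.trans h.2.2.symm⟩) _ _ hv)
    rintro ⟨rfl, rfl⟩
    exact hne (h.2.1.trans h.2.2.symm)
  refine ⟨φ, hc, hac, ?_⟩
  have hstep : ∀ x y, (D.Adj x y ∧ φ x = i ∧ φ y = i) →
      MonoExcept D.Adj φ a b x y ∨ (x = a ∧ y = b) := by
    intro x y h
    by_cases hxy : x = a ∧ y = b
    · exact .inr hxy
    · exact .inl ⟨h.1, hxy, h.2.1.trans h.2.2.symm⟩
  rcases transGen_or_of_transGen_insert hstep hv with h | ⟨h₁, h₂⟩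
  · exact absurd h (hac v)
  · rcases Relation.reflTransGen_iff_eq_or_transGen.1 (h₂.trans h₁) with h | h
    · exact absurd (h ▸ hab) (D.loopless _)
    · exact h

/-- In a 3-dicritical digraph, reversing an arc `ab` yields a digraph with a 2-dicolouring
giving `a` and `b` the same colour. -/
theorem Dicritical3.exists_colouring_reverse_arc {D : SimpleDigraph V} (hD : D.Dicritical3)
    {a b : V} (hab : D.Adj a b) :
    ∃ φ : V → Fin 2, φ a = φ b ∧
      AcyclicRel fun u v => MonoExcept D.Adj φ a b u v ∨ (u = b ∧ v = a) := by
  obtain ⟨φ, hc, hac, hba⟩ := hD.exists_colouring hab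
  refine ⟨φ, hc, fun v hv => hac v (Relation.TransGen.closed ?_ _ _ hv)⟩
  rintro u v (h | ⟨rfl, rfl⟩)
  · exact .single h
  · exact hba

/-- Every arc of a 3-dicritical semi-complete digraph lies in a digon or a directed triangle. -/
theorem Dicritical3.exists_triangle {D : SimpleDigraph V} (hD : D.Dicritical3)
    (hsc : D.SemiComplete) {a b : V} (hab : D.Adj a b) :
    D.Adj b a ∨ ∃ y, D.Adj b y ∧ D.Adj y a := by
  obtain ⟨φ, hc, hac, hba⟩ := hD.exists_colouring hab
  obtain ⟨y, hby, hya⟩ := Relation.TransGen.head'_iff.1 hba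
  rcases Relation.reflTransGen_iff_eq_or_transGen.1 hya with rfl | hya
  · exact .inl hby.1
  by_cases h : D.Adj y a
  · exact .inr ⟨y, hby.1, h⟩
  have hne : y ≠ a := by
    rintro rfl
    exact hac y hya
  have hay := (hsc y a hne).resolve_left h
  refine absurd (hya.tail ⟨hay, fun hy => ?_, hc.trans hby.2.2⟩) (hac y)
  exact D.loopless b (hy.2 ▸ hby.1)

/-- The arc relation of the digraph encoded by the number `g`: there is an arc from `u` to `v`
if and only if the binary digit `16 * u + v` of `g` is one. -/
def arc (g u v : ℕ) : Bool := g.testBit (16 * u + v)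

/-- The encoding of the digraph `g` together with the arc from `i` to `j`. -/
def addArc (g i j : ℕ) : ℕ := g ||| 2 ^ (16 * i + j)

/-- The encoding of the digraph `g` with its arc from `a` to `b` reversed. -/
def reverseArc (g a b : ℕ) : ℕ := addArc (g ^^^ 2 ^ (16 * a + b)) b a

/-- Whether `v` lies in a digon or a directed triangle of `g` with vertices of `S`. -/
def closesCycle (g : ℕ) (S : List ℕ) (v : ℕ) : Bool :=
  S.any fun u => arc g v u && (arc g u v || S.any fun w => arc g u w && arc g w v)

/-- Whether every extension to the vertices of the first list of the partial 2-colouring with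
classes `S` and `T` has a monochromatic digon or directed triangle. -/
def noExtension (g : ℕ) : List ℕ → List ℕ → List ℕ → Bool
  | [], _, _ => false
  | v :: vs, S, T =>
    (closesCycle g S v || noExtension g vs (v :: S) T) &&
      (closesCycle g T v || noExtension g vs S (v :: T))

/-- Whether every 2-colouring of `g` on the vertices `0, …, n - 1`, with its arc from `a` to `b`
reversed, that gives `a` and `b` the same colour, has a monochromatic digon or directed triangle. -/
def arcRefuted (n g a b : ℕ) : Bool :=
  decide (a < n ∧ b < n) && arc g a b &&
    noExtension (reverseArc g a b) ((List.range n).filter fun v => v != a && v != b) [a, b] []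

/-- A decision tree on the orientations of a list of pairs of vertices: `split` branches
on the next pair, `arc a b` claims that the arc from `a` to `b` is refuted, and `last` leaves
the current digraph to a further argument. -/
inductive DecisionTree
  | arc (a b : ℕ)
  | split (s t : DecisionTree)
  | last

/-- Whether the decision tree refutes the digraph `g` on the vertices `0, …, n - 1`,
its leaves `last` being dealt with by `final`. -/
def DecisionTree.refutes (n : ℕ) (final : ℕ → Bool) :
    DecisionTree → List (ℕ × ℕ) → ℕ → Bool
  | .arc a b, _, g => arcRefuted n g a b
  | .last, _, g => final g
  | .split _ _, [], _ => false
  | .split s t, (i, j) :: ps, g =>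
    decide (i < n ∧ j < n ∧ i ≠ j) &&
      s.refutes n final ps (addArc g i j) && t.refutes n final ps (addArc g j i)

/-- Whether `g` can be refuted by placing its arc from `a` to `b` in a digon or a directed triangle.
If the third vertex of the triangle is old, one of the arcs in `es` should be refuted;
if it is the new vertex `n`, the decision tree `t` should apply. -/
def triangleRefuted (n a b : ℕ) (es : List (ℕ × ℕ)) (t : DecisionTree) (ps : List (ℕ × ℕ))
    (g : ℕ) : Bool :=
  decide (n < 16 ∧ a < n ∧ b < n) && arc g a b &&
    (es.any fun e => arcRefuted n (addArc g b a) e.1 e.2) &&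
    ((List.range n).all fun i => i == a || i == b ||
      es.any fun e => arcRefuted n (addArc (addArc g b i) i a) e.1 e.2) &&
    t.refutes (n + 1) (fun _ => false) ps (addArc (addArc g b n) n a)

/-- The injection `f` maps the digraph `g` on the vertices `0, …, n - 1` to a subdigraph
of `D`. -/
structure Realizes (D : SimpleDigraph V) (n g : ℕ) (f : ℕ → V) : Prop where
  le : n ≤ 16
  inj : ∀ i < n, ∀ j < n, f i = f j → i = j
  adj : ∀ u < 16, ∀ v < 16, arc g u v → u < n ∧ v < n ∧ D.Adj (f u) (f v)

theorem arc_addArc {g i j u v : ℕ} (hj : j < 16) (hv : v < 16) :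
    arc (addArc g i j) u v ↔ arc g u v ∨ (u = i ∧ v = j) := by
  simp only [arc, addArc, Nat.testBit_or, Nat.testBit_two_pow, Bool.or_eq_true, decide_eq_true_eq]
  refine or_congr_right ?_
  omega

theorem arc_reverseArc {g a b u v : ℕ} (hab : arc g a b) (ha : a < 16) (hb : b < 16)
    (hv : v < 16) (h : arc (reverseArc g a b) u v) :
    (arc g u v ∧ ¬ (u = a ∧ v = b)) ∨ (u = b ∧ v = a) := by
  rw [reverseArc, arc_addArc ha hv] at h
  refine h.imp_left fun h => ?_
  by_cases huv : u = a ∧ v = b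
  · obtain ⟨rfl, rfl⟩ := huv
    unfold arc at hab h
    simp [Nat.testBit_xor, hab] at h
  · have hne : 16 * a + b ≠ 16 * u + v := by omega
    refine ⟨?_, huv⟩
    simpa [arc, Nat.testBit_xor, Nat.testBit_two_pow, hne] using h

theorem Realizes.addArc {D : SimpleDigraph V} {n g : ℕ} {f : ℕ → V} (h : Realizes D n g f)
    {i j : ℕ} (hi : i < n) (hj : j < n) (hij : D.Adj (f i) (f j)) :
    Realizes D n (addArc g i j) f := by
  refine ⟨h.le, h.inj, fun u hu v hv huv => ?_⟩
  rcases (arc_addArc (hj.trans_le h.le) hv).1 huv with huv | ⟨rfl, rfl⟩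
  · exact h.adj u hu v hv huv
  · exact ⟨hi, hj, hij⟩

theorem Realizes.update {D : SimpleDigraph V} {n g : ℕ} {f : ℕ → V} (h : Realizes D n g f)
    (hn : n < 16) {y : V} (hy : ∀ i < n, f i ≠ y) :
    Realizes D (n + 1) g (Function.update f n y) := by
  have hlt : ∀ i < n, Function.update f n y i = f i := fun i hi =>
    Function.update_of_ne hi.ne _ _
  refine ⟨hn, fun i hi j hj hij => ?_, fun u hu v hv huv => ?_⟩
  · rcases Nat.lt_succ_iff_lt_or_eq.1 hi with hi | rfl <;>
      rcases Nat.lt_succ_iff_lt_or_eq.1 hj with hj | rfl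
    · rw [hlt i hi, hlt j hj] at hij
      exact h.inj i hi j hj hij
    · rw [hlt i hi, Function.update_self] at hij
      exact absurd hij (hy i hi)
    · rw [hlt j hj, Function.update_self] at hij
      exact absurd hij.symm (hy j hj)
    · rfl
  · obtain ⟨hu, hv, huv⟩ := h.adj u hu v hv huv
    rw [hlt u hu, hlt v hv]
    exact ⟨by omega, by omega, huv⟩

section Colouring

variable {R : V → V → Prop} {φ : V → Fin 2} {f : ℕ → V} {n g : ℕ}

theorem not_closesCycle (hR : AcyclicRel R)
    (hg : ∀ u < n, ∀ v < n, arc g u v → φ (f u) = φ (f v) → R (f u) (f v))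
    {S : List ℕ} {v : ℕ} (hv : v < n) (hS : ∀ u ∈ S, u < n ∧ φ (f u) = φ (f v)) :
    ¬ closesCycle g S v := by
  intro h
  simp only [closesCycle, List.any_eq_true, Bool.and_eq_true, Bool.or_eq_true] at h
  obtain ⟨u, hu, hvu, h⟩ := h
  obtain ⟨hun, huc⟩ := hS u hu
  have h₁ : R (f v) (f u) := hg v hv u hun hvu huc.symm
  rcases h with huv | ⟨w, hw, huw, hwv⟩
  · exact hR _ ((Relation.TransGen.single h₁).tail (hg u hun v hv huv huc))
  · obtain ⟨hwn, hwc⟩ := hS w hw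
    exact hR _ (((Relation.TransGen.single h₁).tail
      (hg u hun w hwn huw (huc.trans hwc.symm))).tail (hg w hwn v hv hwv hwc))

theorem not_noExtension (hR : AcyclicRel R)
    (hg : ∀ u < n, ∀ v < n, arc g u v → φ (f u) = φ (f v) → R (f u) (f v)) (c : Fin 2) :
    ∀ vs S T : List ℕ, (∀ v ∈ vs, v < n) → (∀ u ∈ S, u < n ∧ φ (f u) = c) →
      (∀ u ∈ T, u < n ∧ φ (f u) = 1 - c) → ¬ noExtension g vs S T
  | [], _, _, _, _, _ => by simp [noExtension]
  | v :: vs, S, T, hvs, hS, hT => by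
    obtain ⟨hv, hvs⟩ := List.forall_mem_cons.1 hvs
    simp only [noExtension, Bool.and_eq_true, Bool.or_eq_true]
    rintro ⟨h₁, h₂⟩
    have hc : φ (f v) = c ∨ φ (f v) = 1 - c := by omega
    rcases hc with hc | hc
    · refine h₁.elim (not_closesCycle hR hg hv fun u hu => ⟨(hS u hu).1, ?_⟩)
        (not_noExtension hR hg c vs _ _ hvs (List.forall_mem_cons.2 ⟨⟨hv, hc⟩, hS⟩) hT)
      rw [(hS u hu).2, hc]
    · refine h₂.elim (not_closesCycle hR hg hv fun u hu => ⟨(hT u hu).1, ?_⟩)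
        (not_noExtension hR hg c vs _ _ hvs hS (List.forall_mem_cons.2 ⟨⟨hv, hc⟩, hT⟩))
      rw [(hT u hu).2, hc]

end Colouring

section Refutation

variable {D : SimpleDigraph V} {n g : ℕ} {f : ℕ → V}

theorem Realizes.not_arcRefuted (h : Realizes D n g f) (hD : D.Dicritical3) (a b : ℕ) :
    ¬ arcRefuted n g a b := by
  simp only [arcRefuted, Bool.and_eq_true, decide_eq_true_eq]
  rintro ⟨⟨⟨ha, hb⟩, hab⟩, hno⟩
  have hn := h.le
  obtain ⟨φ, hc, hac⟩ := hD.exists_colouring_reverse_arc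
    (h.adj a (by omega) b (by omega) hab).2.2
  refine not_noExtension (n := n) (f := f) (φ := φ) hac ?_ (φ (f a)) _ _ _ ?_ ?_ ?_ hno
  · intro u hu v hv huv hφ
    rcases arc_reverseArc hab (by omega) (by omega) (by omega) huv with ⟨huv, hne⟩ | ⟨rfl, rfl⟩
    · exact .inl ⟨(h.adj u (by omega) v (by omega) huv).2.2,
        fun he => hne ⟨h.inj u hu a ha he.1, h.inj v hv b hb he.2⟩, hφ⟩
    · exact .inr ⟨rfl, rfl⟩
  · intro v hv
    exact List.mem_range.1 (List.mem_filter.1 hv).1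
  · simp [ha, hb, hc]
  · simp

theorem DecisionTree.not_refutes (hD : D.Dicritical3) (hsc : D.SemiComplete) {final : ℕ → Bool}
    (hfinal : ∀ g, Realizes D n g f → ¬ final g) :
    ∀ (t : DecisionTree) (ps : List (ℕ × ℕ)) (g : ℕ), Realizes D n g f →
      ¬ t.refutes n final ps g
  | .arc a b, _, _, h => h.not_arcRefuted hD a b
  | .last, _, g, h => hfinal g h
  | .split _ _, [], _, _ => by simp [refutes]
  | .split s t, (i, j) :: ps, g, h => by
    simp only [refutes, Bool.and_eq_true, decide_eq_true_eq]
    rintro ⟨⟨⟨hi, hj, hij⟩, hs⟩, ht⟩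
    rcases hsc (f i) (f j) fun he => hij (h.inj i hi j hj he) with hadj | hadj
    · exact not_refutes hD hsc hfinal s ps _ (h.addArc hi hj hadj) hs
    · exact not_refutes hD hsc hfinal t ps _ (h.addArc hj hi hadj) ht

theorem Realizes.not_triangleRefuted (h : Realizes D n g f) (hD : D.Dicritical3)
    (hsc : D.SemiComplete) (a b : ℕ) (es : List (ℕ × ℕ)) (t : DecisionTree)
    (ps : List (ℕ × ℕ)) : ¬ triangleRefuted n a b es t ps g := by
  simp only [triangleRefuted, Bool.and_eq_true, decide_eq_true_eq, List.any_eq_true,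
    List.all_eq_true, List.mem_range, Bool.or_eq_true, beq_iff_eq]
  rintro ⟨⟨⟨⟨⟨hn, ha, hb⟩, hab⟩, e, -, hdigon⟩, hold⟩, hnew⟩
  rcases hD.exists_triangle hsc (h.adj a (by omega) b (by omega) hab).2.2 with hba | ⟨y, hby, hya⟩
  · exact (h.addArc hb ha hba).not_arcRefuted hD _ _ hdigon
  by_cases hy : ∃ i < n, f i = y
  · obtain ⟨i, hi, rfl⟩ := hy
    rcases hold i hi with (rfl | rfl) | ⟨e, -, he⟩
    · exact D.loopless _ hya
    · exact D.loopless _ hby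
    · exact ((h.addArc hb hi hby).addArc hi ha hya).not_arcRefuted hD _ _ he
  · push Not at hy
    have hf : ∀ i < n, Function.update f n y i = f i := fun i hi =>
      Function.update_of_ne hi.ne _ _
    have h' := h.update hn hy
    refine t.not_refutes hD hsc (f := Function.update f n y) (by simp) ps _ ?_ hnew
    refine (h'.addArc (by omega) (by omega) ?_).addArc (by omega) (by omega) ?_
    · rwa [hf b hb, Function.update_self]
    · rwa [hf a ha, Function.update_self]

end Refutation

/-- The encoding of `F⁺`. -/
def encodedFplus : ℕ :=
  [(0, 1), (0, 2), (0, 3), (0, 4), (0, 5), (1, 2), (1, 3), (1, 4), (1, 5), (2, 3), (2, 4), (2, 5),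
    (3, 4), (3, 5), (4, 5), (1, 6), (6, 0), (3, 7), (7, 2), (5, 8), (8, 4), (9, 0), (9, 1), (9, 2),
    (9, 3), (9, 4), (9, 5)].foldl (fun g p => addArc g p.1 p.2) 0

/-- The pairs of vertices of `F⁺` that are not joined by an arc. -/
def pairsFplus : List (ℕ × ℕ) :=
  [(1, 7), (4, 7), (0, 7), (4, 6), (6, 7), (3, 6), (5, 7), (5, 6), (2, 6), (6, 9), (7, 9), (6, 8),
  (7, 8), (0, 8), (2, 8), (3, 8), (1, 8), (8, 9)]

/-- A decision tree refuting all but one of the tournaments on the vertices of `F⁺`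
that contain `F⁺`. -/
def treeFplus : DecisionTree :=
  .split (.split (.split (.split (.split (.split (.split (.split (.split (.split (.split (.arc 1
  7) (.split (.split (.split (.split (.arc 0 8) (.arc 9 4)) (.arc 9 4)) (.split (.arc 0 7) (.arc 9
  4))) (.split (.arc 9 3) (.split (.arc 0 7) (.arc 8 7))))) (.split (.arc 9 5) (.arc 9 7)))
  (.split (.split (.arc 1 7) (.split (.split (.split (.split (.arc 0 8) (.arc 0 4)) (.arc 9 4))
  (.split (.arc 0 7) (.arc 9 4))) (.split (.arc 9 3) (.split (.arc 0 7) (.arc 8 7))))) (.arc 9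
  2))) (.split (.split (.split (.arc 1 5) (.split (.split (.split (.split (.arc 0 8) (.arc 9 2))
  (.arc 1 5)) (.split (.arc 0 7) (.arc 1 5))) (.split (.arc 9 7) (.split (.arc 0 7) (.arc 8 7)))))
  (.arc 9 5)) (.arc 1 5))) (.arc 0 5)) (.arc 1 7)) (.split (.split (.split (.split (.arc 1 6)
  (.arc 0 5)) (.arc 9 5)) (.arc 0 5)) (.arc 0 5))) (.split (.split (.split (.split (.arc 1 7)
  (.split (.split (.split (.arc 1 5) (.split (.split (.split (.split (.arc 0 8) (.arc 1 4)) (.arc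
  1 7)) (.arc 6 7)) (.split (.arc 9 7) (.split (.arc 0 7) (.arc 8 7))))) (.arc 9 5)) (.arc 1 5)))
  (.arc 0 5)) (.split (.split (.arc 1 7) (.split (.split (.split (.arc 1 5) (.split (.split
  (.split (.split (.arc 0 8) (.arc 1 4)) (.split (.arc 9 4) (.arc 1 5))) (.arc 6 7)) (.split (.arc
  9 7) (.split (.arc 0 7) (.split (.arc 9 5) (.arc 8 4)))))) (.arc 9 5)) (.split (.split (.arc 6
  2) (.split (.split (.split (.split (.arc 6 8) (.split (.arc 9 4) (.split (.split (.arc 6 4)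
  (.last)) (.arc 0 2)))) (.split (.arc 9 4) (.arc 6 2))) (.arc 6 7)) (.split (.arc 9 7) (.split
  (.arc 0 7) (.split (.arc 9 5) (.split (.arc 9 5) (.split (.arc 9 5) (.arc 8 4)))))))) (.arc 9
  5)))) (.arc 0 5))) (.arc 9 4))) (.split (.split (.split (.split (.split (.split (.arc 9 2)
  (.split (.split (.split (.split (.split (.arc 6 8) (.arc 9 4)) (.split (.arc 1 7) (.arc 9 4)))
  (.split (.arc 9 3) (.split (.arc 1 7) (.split (.arc 9 2) (.arc 8 2))))) (.arc 9 2)) (.arc 9 2)))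
  (.arc 1 5)) (.arc 1 5)) (.arc 1 7)) (.split (.split (.split (.split (.arc 1 6) (.split (.split
  (.split (.split (.split (.arc 7 8) (.arc 9 4)) (.arc 9 3)) (.split (.split (.arc 1 6) (.arc 9
  4)) (.split (.arc 1 6) (.split (.arc 9 2) (.arc 8 2))))) (.arc 9 5)) (.arc 9 2))) (.arc 9 5))
  (.arc 1 5)) (.arc 9 3))) (.split (.split (.arc 1 4) (.split (.split (.arc 1 7) (.split (.arc 1
  5) (.split (.split (.split (.split (.split (.arc 6 8) (.arc 9 4)) (.arc 6 7)) (.split (.arc 9 3)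
  (.split (.arc 6 2) (.split (.arc 9 5) (.arc 8 2))))) (.arc 9 2)) (.arc 9 5)))) (.arc 1 5)))
  (.arc 9 4)))) (.arc 1 4)) (.split (.split (.split (.split (.arc 0 2) (.split (.split (.split
  (.split (.split (.split (.arc 0 5) (.arc 9 5)) (.split (.split (.split (.split (.split (.arc 0
  8) (.arc 9 4)) (.arc 0 5)) (.arc 1 6)) (.split (.split (.split (.arc 2 6) (.arc 9 4)) (.arc 9
  4)) (.split (.arc 0 7) (.split (.arc 2 6) (.arc 8 6))))) (.arc 9 6))) (.arc 0 5)) (.arc 9 5))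
  (.arc 0 5)) (.arc 0 5))) (.split (.split (.arc 0 2) (.split (.split (.arc 1 4) (.split (.split
  (.split (.arc 1 5) (.split (.split (.split (.split (.arc 0 8) (.arc 1 4)) (.arc 1 3)) (.arc 6
  7)) (.split (.arc 1 4) (.split (.arc 0 7) (.split (.arc 9 5) (.arc 8 4)))))) (.arc 9 5)) (.split
  (.split (.arc 6 2) (.split (.split (.split (.split (.arc 6 8) (.arc 1 4)) (.arc 9 2)) (.arc 6
  7)) (.split (.arc 1 4) (.split (.arc 0 7) (.split (.arc 9 5) (.split (.arc 9 5) (.arc 8 4)))))))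
  (.arc 9 5)))) (.arc 0 5))) (.arc 9 4))) (.split (.split (.split (.arc 1 4) (.arc 1 5)) (.split
  (.arc 3 6) (.arc 9 3))) (.split (.split (.arc 1 4) (.split (.split (.arc 1 4) (.split (.arc 1 5)
  (.split (.split (.split (.split (.arc 6 8) (.arc 6 7)) (.split (.arc 1 4) (.split (.arc 6 2)
  (.split (.arc 9 5) (.arc 8 2))))) (.split (.split (.arc 6 8) (.arc 6 7)) (.split (.arc 1 4)
  (.split (.arc 9 2) (.split (.arc 9 5) (.arc 8 2)))))) (.arc 9 5)))) (.split (.arc 9 5) (.arc 6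
  5)))) (.arc 9 4)))) (.split (.arc 0 4) (.split (.split (.arc 9 4) (.split (.split (.split (.arc
  3 6) (.arc 9 5)) (.split (.split (.split (.split (.arc 7 0) (.arc 9 5)) (.split (.split (.split
  (.split (.arc 7 8) (.split (.arc 9 4) (.split (.arc 9 4) (.arc 7 0)))) (.arc 1 6)) (.split (.arc
  7 6) (.split (.split (.arc 2 6) (.split (.arc 9 5) (.arc 8 6))) (.split (.arc 9 5) (.split (.arc
  9 5) (.arc 8 4)))))) (.arc 9 5))) (.arc 7 2)) (.arc 7 5))) (.split (.split (.arc 9 3) (.arc 0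
  5)) (.split (.split (.split (.split (.split (.split (.arc 7 8) (.split (.split (.split (.arc 0
  8) (.arc 9 4)) (.arc 9 4)) (.arc 9 4))) (.split (.arc 7 6) (.split (.split (.arc 2 6) (.split
  (.arc 0 5) (.arc 8 4))) (.split (.arc 9 5) (.arc 8 4))))) (.arc 9 5)) (.arc 9 3)) (.arc 7 2))
  (.arc 7 5))))) (.split (.split (.split (.arc 1 5) (.split (.arc 9 5) (.split (.split (.arc 9 2)
  (.arc 9 5)) (.arc 1 5)))) (.arc 6 4)) (.arc 7 4)))))

/-- A decision tree refuting the remaining tournament together with an eleventh vertex that forms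
a directed triangle with the arc from `0` to `3`. -/
def treeTriangle : DecisionTree :=
  .split (.split (.split (.split (.arc 6 10) (.arc 0 4)) (.arc 0 4)) (.arc 9 5)) (.split (.arc 6
  7) (.split (.arc 9 3) (.arc 10 7)))

theorem refutes_encodedFplus :
    treeFplus.refutes 10
      (triangleRefuted 10 0 3 [(9, 2), (6, 7)] treeTriangle
        [(7, 10), (6, 10), (1, 10), (2, 10), (4, 10), (9, 10), (8, 10), (5, 10)])
      pairsFplus encodedFplus := by
  decide +kernel

instance : DecidableRel digraphFplus.Adj := fun u v => by
  unfold digraphFplus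
  infer_instance

theorem Dicritical3.not_containsSub_Fplus {D : SimpleDigraph V} (hD : D.Dicritical3)
    (hsc : D.SemiComplete) : ¬ D.ContainsSub digraphFplus := by
  rintro ⟨f, hf, hadj⟩
  refine DecisionTree.not_refutes (f := fun k => f (Fin.ofNat 10 k)) hD hsc
    (fun g h => h.not_triangleRefuted hD hsc _ _ _ _ _) _ _ _ ⟨by norm_num, ?_, ?_⟩
    refutes_encodedFplus
  · intro i hi j hj hij
    simpa [Fin.ext_iff, Nat.mod_eq_of_lt hi, Nat.mod_eq_of_lt hj] using hf hij
  · have harc : ∀ u < 16, ∀ v < 16, arc encodedFplus u v →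
        u < 10 ∧ v < 10 ∧ digraphFplus.Adj (Fin.ofNat 10 u) (Fin.ofNat 10 v) := by
      decide +kernel
    intro u hu v hv huv
    obtain ⟨hu, hv, huv⟩ := harc u hu v hv huv
    exact ⟨hu, hv, hadj _ _ huv⟩

theorem ContainsSub.reverse_Fplus {D : SimpleDigraph V} (h : D.ContainsSub digraphFminus) :
    D.reverse.ContainsSub digraphFplus := by
  obtain ⟨f, hf, hadj⟩ := h
  let σ : Fin 10 → Fin 10 := ![5, 4, 3, 2, 1, 0, 8, 7, 6, 9]
  have hσ : Function.Injective σ := by decide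
  have hrev : ∀ a b, digraphFplus.Adj a b → digraphFminus.Adj (σ b) (σ a) := by
    unfold digraphFplus digraphFminus
    decide
  exact ⟨f ∘ σ, hf.comp hσ, fun a b hab => hadj _ _ (hrev a b hab)⟩

end SimpleDigraph

/-- A 3-dicritical semi-complete digraph contains neither `F⁺` nor `F⁻`
as a subdigraph. -/
theorem dicritical3_Fplus_Fminus_free
    {V : Type} [Fintype V] (D : SimpleDigraph V) (hD : D.Dicritical3)
    (hsc : D.SemiComplete) :
    ¬ D.ContainsSub digraphFplus ∧ ¬ D.ContainsSub digraphFminus := by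
  exact ⟨hD.not_containsSub_Fplus hsc,
    fun h => hD.reverse.not_containsSub_Fplus hsc.reverse h.reverse_Fplus⟩
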